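/- arXiv:1708.00056 — 4 statements merged into one kernel-verified Lean document; each statement's English description precedes it below -/
import Mathlib

section
/- Let k ∈ ℂ and let U ⊆ ℝ³ be open. Let A, Q : ℝ³ → ℂ³ and φ, ψ : ℝ³ → ℂ be twice continuously differentiable on U, and suppose each satisfies the Helmholtz equation on U: ΔA + k²A = 0 and ΔQ + k²Q = 0 (componentwise), Δφ + k²φ = 0, Δψ + k²ψ = 0. Suppose furthermore the consistency conditions div A = ik φ and div Q = ik ψ hold on U. Define E = ik A − ∇φ − curl Q and H = ik Q − ∇ψ + curl A on U. Then on U the time-harmonic Maxwell equations hold: curl E = ik H, curl H = −ik E, div E = 0, and div H = 0. -/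
noncomputable section

/-- Partial derivative in the `i`-th coordinate direction of a `ℂ`-valued
function on `ℝ³`. -/
def pd (i : Fin 3) (f : (Fin 3 → ℝ) → ℂ) : (Fin 3 → ℝ) → ℂ :=
  fun x => fderiv ℝ f x (Pi.single i 1)

/-- Divergence of a `ℂ³`-valued vector field on `ℝ³`. -/
def vdiv (F : (Fin 3 → ℝ) → Fin 3 → ℂ) : (Fin 3 → ℝ) → ℂ :=
  fun x => pd 0 (fun y => F y 0) x + pd 1 (fun y => F y 1) x + pd 2 (fun y => F y 2) x

/-- Curl of a `ℂ³`-valued vector field on `ℝ³`. -/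
def vcurl (F : (Fin 3 → ℝ) → Fin 3 → ℂ) : (Fin 3 → ℝ) → Fin 3 → ℂ :=
  fun x => ![pd 1 (fun y => F y 2) x - pd 2 (fun y => F y 1) x,
             pd 2 (fun y => F y 0) x - pd 0 (fun y => F y 2) x,
             pd 0 (fun y => F y 1) x - pd 1 (fun y => F y 0) x]

/-- Gradient of a `ℂ`-valued function on `ℝ³`. -/
def vgrad (f : (Fin 3 → ℝ) → ℂ) : (Fin 3 → ℝ) → Fin 3 → ℂ :=
  fun x => ![pd 0 f x, pd 1 f x, pd 2 f x]

/-- Laplacian of a `ℂ`-valued function on `ℝ³`. -/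
def lap (f : (Fin 3 → ℝ) → ℂ) : (Fin 3 → ℝ) → ℂ :=
  fun x => pd 0 (pd 0 f) x + pd 1 (pd 1 f) x + pd 2 (pd 2 f) x

theorem debye_pd_diff {U : Set (Fin 3 → ℝ)} (hU : IsOpen U) {f : (Fin 3 → ℝ) → ℂ}
    (hf : ContDiffOn ℝ 2 f U) {x : Fin 3 → ℝ} (hx : x ∈ U) (i : Fin 3) :
    DifferentiableAt ℝ (pd i f) x := by
  have h1 : ContDiffAt ℝ 2 f x := hf.contDiffAt (hU.mem_nhds hx)
  have h2 : DifferentiableAt ℝ (fderiv ℝ f) x :=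
    (h1.fderiv_right (m := 1) (by norm_num)).differentiableAt (by norm_num)
  exact h2.clm_apply (differentiableAt_const _)

theorem debye_pd_symm {U : Set (Fin 3 → ℝ)} (hU : IsOpen U) {f : (Fin 3 → ℝ) → ℂ}
    (hf : ContDiffOn ℝ 2 f U) {x : Fin 3 → ℝ} (hx : x ∈ U) (i j : Fin 3) :
    pd i (pd j f) x = pd j (pd i f) x := by
  have h1 : ContDiffAt ℝ 2 f x := hf.contDiffAt (hU.mem_nhds hx)
  have h2 : DifferentiableAt ℝ (fderiv ℝ f) x :=
    (h1.fderiv_right (m := 1) (by norm_num)).differentiableAt (by norm_num)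
  have h3 : IsSymmSndFDerivAt ℝ f x := h1.isSymmSndFDerivAt (by simp)
  have key : ∀ a b : Fin 3, pd a (pd b f) x
      = fderiv ℝ (fderiv ℝ f) x (Pi.single a 1) (Pi.single b 1) := by
    intro a b
    unfold pd
    rw [fderiv_clm_apply h2 (differentiableAt_const _)]
    simp
  rw [key, key]
  exact h3 _ _

theorem debye_pd_add {f g : (Fin 3 → ℝ) → ℂ} {x : Fin 3 → ℝ} (i : Fin 3)
    (hf : DifferentiableAt ℝ f x) (hg : DifferentiableAt ℝ g x) :
    pd i (fun y => f y + g y) x = pd i f x + pd i g x := by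
  unfold pd
  rw [fderiv_fun_add hf hg]; rfl

theorem debye_pd_sub {f g : (Fin 3 → ℝ) → ℂ} {x : Fin 3 → ℝ} (i : Fin 3)
    (hf : DifferentiableAt ℝ f x) (hg : DifferentiableAt ℝ g x) :
    pd i (fun y => f y - g y) x = pd i f x - pd i g x := by
  unfold pd
  rw [fderiv_fun_sub hf hg]; rfl

theorem debye_pd_mul {f : (Fin 3 → ℝ) → ℂ} {x : Fin 3 → ℝ} (i : Fin 3) (c : ℂ)
    (hf : DifferentiableAt ℝ f x) :
    pd i (fun y => c * f y) x = c * pd i f x := by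
  unfold pd
  rw [fderiv_const_mul hf]; rfl

theorem debye_pd_cons {U : Set (Fin 3 → ℝ)} (hU : IsOpen U)
    {A : (Fin 3 → ℝ) → Fin 3 → ℂ} {φ : (Fin 3 → ℝ) → ℂ} (c : ℂ)
    (hA : ∀ i : Fin 3, ContDiffOn ℝ 2 (fun x => A x i) U)
    (hφ : ContDiffOn ℝ 2 φ U) (h : ∀ x ∈ U, vdiv A x = c * φ x)
    {x : Fin 3 → ℝ} (hx : x ∈ U) (i : Fin 3) :
    pd i (pd 0 (fun y => A y 0)) x + pd i (pd 1 (fun y => A y 1)) x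
      + pd i (pd 2 (fun y => A y 2)) x = c * pd i φ x := by
  have hev : vdiv A =ᶠ[nhds x] fun y => c * φ y :=
    Filter.eventually_of_mem (hU.mem_nhds hx) h
  have h1 : pd i (vdiv A) x = pd i (fun y => c * φ y) x := by
    unfold pd; rw [hev.fderiv_eq]
  have d := fun j a => debye_pd_diff hU (hA j) hx a
  rw [debye_pd_mul i c ((hφ.contDiffAt (hU.mem_nhds hx)).differentiableAt (by norm_num))] at h1
  rw [← h1]
  unfold vdiv
  rw [debye_pd_add i ((d 0 0).fun_add (d 1 1)) (d 2 2), debye_pd_add i (d 0 0) (d 1 1)]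

/-- derivative of one component of a Debye field -/
theorem debye_pd_field (c : ℂ) {e a p q r : (Fin 3 → ℝ) → ℂ} {x : Fin 3 → ℝ} (i : Fin 3)
    (h : ∀ y, e y = c * a y - p y - (q y - r y))
    (ha : DifferentiableAt ℝ a x) (hp : DifferentiableAt ℝ p x)
    (hq : DifferentiableAt ℝ q x) (hr : DifferentiableAt ℝ r x) :
    pd i e x
      = c * pd i a x - pd i p x - (pd i q x - pd i r x) := by
  rw [show e = fun y => c * a y - p y - (q y - r y) from funext h,
    debye_pd_sub i ((ha.const_mul c).fun_sub hp) (hq.fun_sub hr),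
    debye_pd_sub i (ha.const_mul c) hp, debye_pd_sub i hq hr, debye_pd_mul i c ha]

theorem debye_pd_field_add (c : ℂ) {e a p q r : (Fin 3 → ℝ) → ℂ} {x : Fin 3 → ℝ} (i : Fin 3)
    (h : ∀ y, e y = c * a y - p y + (q y - r y))
    (ha : DifferentiableAt ℝ a x) (hp : DifferentiableAt ℝ p x)
    (hq : DifferentiableAt ℝ q x) (hr : DifferentiableAt ℝ r x) :
    pd i e x
      = c * pd i a x - pd i p x + (pd i q x - pd i r x) := by
  rw [show e = fun y => c * a y - p y + (q y - r y) from funext h,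
    debye_pd_add i ((ha.const_mul c).fun_sub hp) (hq.fun_sub hr),
    debye_pd_sub i (ha.const_mul c) hp, debye_pd_sub i hq hr, debye_pd_mul i c ha]

/-- The generalized Debye source representation
`E = ikA − ∇φ − curl Q`, `H = ikQ − ∇ψ + curl A`, with the potentials
satisfying the Helmholtz equation and the consistency conditions
`div A = ikφ`, `div Q = ikψ`, produces a solution of the time-harmonic
Maxwell equations. -/
theorem generalized_debye_sources_satisfy_maxwell
    (k : ℂ) (U : Set (Fin 3 → ℝ)) (hU : IsOpen U)
    (A Q : (Fin 3 → ℝ) → Fin 3 → ℂ) (φ ψ : (Fin 3 → ℝ) → ℂ)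
    (hA : ∀ i : Fin 3, ContDiffOn ℝ 2 (fun x => A x i) U)
    (hQ : ∀ i : Fin 3, ContDiffOn ℝ 2 (fun x => Q x i) U)
    (hφ : ContDiffOn ℝ 2 φ U) (hψ : ContDiffOn ℝ 2 ψ U)
    (hAhelm : ∀ x ∈ U, ∀ i : Fin 3, lap (fun y => A y i) x + k ^ 2 * A x i = 0)
    (hQhelm : ∀ x ∈ U, ∀ i : Fin 3, lap (fun y => Q y i) x + k ^ 2 * Q x i = 0)
    (hφhelm : ∀ x ∈ U, lap φ x + k ^ 2 * φ x = 0)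
    (hψhelm : ∀ x ∈ U, lap ψ x + k ^ 2 * ψ x = 0)
    (hconsA : ∀ x ∈ U, vdiv A x = Complex.I * k * φ x)
    (hconsQ : ∀ x ∈ U, vdiv Q x = Complex.I * k * ψ x)
    (E H : (Fin 3 → ℝ) → Fin 3 → ℂ)
    (hE : ∀ x, E x = (Complex.I * k) • A x - vgrad φ x - vcurl Q x)
    (hH : ∀ x, H x = (Complex.I * k) • Q x - vgrad ψ x + vcurl A x) :
    ∀ x ∈ U,
      vcurl E x = (Complex.I * k) • H x ∧
      vcurl H x = (-(Complex.I * k)) • E x ∧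
      vdiv E x = 0 ∧
      vdiv H x = 0 := by
  intro x hx
  have dA := fun j => ((hA j).contDiffAt (hU.mem_nhds hx)).differentiableAt (by norm_num)
  have dQ := fun j => ((hQ j).contDiffAt (hU.mem_nhds hx)).differentiableAt (by norm_num)
  have ddA := fun j a => debye_pd_diff hU (hA j) hx a
  have ddQ := fun j a => debye_pd_diff hU (hQ j) hx a
  have ddφ := fun a => debye_pd_diff hU hφ hx a
  have ddψ := fun a => debye_pd_diff hU hψ hx a
  have E0 := fun i => debye_pd_field (e := fun y => E y 0) (Complex.I * k) i
    (fun y => by rw [hE]; rfl) (dA 0) (ddφ 0) (ddQ 2 1) (ddQ 1 2)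
  have E1 := fun i => debye_pd_field (e := fun y => E y 1) (Complex.I * k) i
    (fun y => by rw [hE]; rfl) (dA 1) (ddφ 1) (ddQ 0 2) (ddQ 2 0)
  have E2 := fun i => debye_pd_field (e := fun y => E y 2) (Complex.I * k) i
    (fun y => by rw [hE]; rfl) (dA 2) (ddφ 2) (ddQ 1 0) (ddQ 0 1)
  have H0 := fun i => debye_pd_field_add (e := fun y => H y 0) (Complex.I * k) i
    (fun y => by rw [hH]; rfl) (dQ 0) (ddψ 0) (ddA 2 1) (ddA 1 2)
  have H1 := fun i => debye_pd_field_add (e := fun y => H y 1) (Complex.I * k) i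
    (fun y => by rw [hH]; rfl) (dQ 1) (ddψ 1) (ddA 0 2) (ddA 2 0)
  have H2 := fun i => debye_pd_field_add (e := fun y => H y 2) (Complex.I * k) i
    (fun y => by rw [hH]; rfl) (dQ 2) (ddψ 2) (ddA 1 0) (ddA 0 1)
  have sA := fun j a b => debye_pd_symm hU (hA j) hx a b
  have sQ := fun j a b => debye_pd_symm hU (hQ j) hx a b
  have sφ := fun a b => debye_pd_symm hU hφ hx a b
  have sψ := fun a b => debye_pd_symm hU hψ hx a b
  have cA := fun i => debye_pd_cons hU _ hA hφ hconsA hx i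
  have cQ := fun i => debye_pd_cons hU _ hQ hψ hconsQ hx i
  have lA := hAhelm x hx
  have lQ := hQhelm x hx
  have lφ := hφhelm x hx
  have lψ := hψhelm x hx
  have vA := hconsA x hx
  have vQ := hconsQ x hx
  have hI : Complex.I ^ 2 = -1 := Complex.I_sq
  simp only [lap] at lA lQ lφ lψ
  simp only [vdiv] at vA vQ
  refine ⟨?_, ?_, ?_, ?_⟩
  · rw [hH]
    ext j
    fin_cases j
    · change pd 1 (fun y => E y 2) x - pd 2 (fun y => E y 1) x
        = Complex.I * k * (Complex.I * k * Q x 0 - pd 0 ψ x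
          + (pd 1 (fun y => A y 2) x - pd 2 (fun y => A y 1) x))
      rw [E1, E2]
      linear_combination lQ 0 - cQ 0 - sφ 1 2 + sQ 1 0 1 + sQ 2 0 2 - k ^ 2 * Q x 0 * hI
    · change pd 2 (fun y => E y 0) x - pd 0 (fun y => E y 2) x
        = Complex.I * k * (Complex.I * k * Q x 1 - pd 1 ψ x
          + (pd 2 (fun y => A y 0) x - pd 0 (fun y => A y 2) x))
      rw [E2, E0]
      linear_combination lQ 1 - cQ 1 - sφ 2 0 + sQ 0 1 0 + sQ 2 1 2 - k ^ 2 * Q x 1 * hI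
    · change pd 0 (fun y => E y 1) x - pd 1 (fun y => E y 0) x
        = Complex.I * k * (Complex.I * k * Q x 2 - pd 2 ψ x
          + (pd 0 (fun y => A y 1) x - pd 1 (fun y => A y 0) x))
      rw [E0, E1]
      linear_combination lQ 2 - cQ 2 - sφ 0 1 + sQ 0 2 0 + sQ 1 2 1 - k ^ 2 * Q x 2 * hI
  · rw [hE]
    ext j
    fin_cases j
    · change pd 1 (fun y => H y 2) x - pd 2 (fun y => H y 1) x
        = -(Complex.I * k) * (Complex.I * k * A x 0 - pd 0 φ x
          - (pd 1 (fun y => Q y 2) x - pd 2 (fun y => Q y 1) x))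
      rw [H1, H2]
      linear_combination -(lA 0 - cA 0) - sψ 1 2 - sA 1 0 1 - sA 2 0 2 + k ^ 2 * A x 0 * hI
    · change pd 2 (fun y => H y 0) x - pd 0 (fun y => H y 2) x
        = -(Complex.I * k) * (Complex.I * k * A x 1 - pd 1 φ x
          - (pd 2 (fun y => Q y 0) x - pd 0 (fun y => Q y 2) x))
      rw [H2, H0]
      linear_combination -(lA 1 - cA 1) - sψ 2 0 - sA 0 1 0 - sA 2 1 2 + k ^ 2 * A x 1 * hI
    · change pd 0 (fun y => H y 1) x - pd 1 (fun y => H y 0) x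
        = -(Complex.I * k) * (Complex.I * k * A x 2 - pd 2 φ x
          - (pd 0 (fun y => Q y 1) x - pd 1 (fun y => Q y 0) x))
      rw [H0, H1]
      linear_combination -(lA 2 - cA 2) - sψ 0 1 - sA 0 2 0 - sA 1 2 1 + k ^ 2 * A x 2 * hI
  · simp only [vdiv, E0, E1, E2]
    linear_combination Complex.I * k * vA - lφ + k ^ 2 * φ x * hI
      - sQ 2 0 1 - sQ 0 1 2 - sQ 1 2 0
  · simp only [vdiv, H0, H1, H2]
    linear_combination Complex.I * k * vQ - lψ + k ^ 2 * ψ x * hI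
      + sA 2 0 1 + sA 0 1 2 + sA 1 2 0
end
end

section
/- Let L > 0, m ∈ ℤ, θ ∈ ℝ, and fix s ∈ [0, L]. Let (r, z) : [0,L] → ℝ² be a C¹ generating curve with r > 0, and let K : [0,L] × [0,L] × ℝ → ℂ be such that for each s′ the function φ ↦ K(s, s′, φ) is 2π-periodic and integrable on [−π, π]; let u_τ, u_θ : [0,L] → ℂ be such that the integrand below is integrable on [0,L] × [−π, π]. Then, with τ̂(s′, θ′) = r′(s′) r̂(θ′) + z′(s′) k̂, the following identity of vectors in ℂ³ holds: ∫_0^L ∫_{−π}^{π} K(s, s′, θ − θ′) [ u_τ(s′) τ̂(s′, θ′) + u_θ(s′) θ̂(θ′) ] e^{imθ′} r(s′) dθ′ ds′ = e^{imθ} [ r̂(θ) ∫_0^L ( K_m^{cos}(s,s′) r′(s′) u_τ(s′) + K_m^{sin}(s,s′) u_θ(s′) ) r(s′) ds′ + θ̂(θ) ∫_0^L ( K_m^{cos}(s,s′) u_θ(s′) − K_m^{sin}(s,s′) r′(s′) u_τ(s′) ) r(s′) ds′ + k̂ ∫_0^L K_m(s,s′) z′(s′) u_τ(s′) r(s′)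 ds′ ], where K_m, K_m^{cos}, K_m^{sin} denote the modes ∫_{−π}^{π} K(s,s′,φ) e^{−imφ} dφ, ∫_{−π}^{π} K(s,s′,φ) cos(φ) e^{−imφ} dφ, ∫_{−π}^{π} K(s,s′,φ) sin(φ) e^{−imφ} dφ. -/
open scoped Real
open MeasureTheory

noncomputable section

/-- The cylindrical unit vector `r̂(t) = (cos t, sin t, 0)`, regarded in `ℂ³`. -/
def rhat3 (t : ℝ) : Fin 3 → ℂ := ![Real.cos t, Real.sin t, 0]

/-- The cylindrical unit vector `θ̂(t) = (−sin t, cos t, 0)`, regarded in `ℂ³`. -/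
def thetahat3 (t : ℝ) : Fin 3 → ℂ := ![-Real.sin t, Real.cos t, 0]

/-- The vertical unit vector `k̂ = (0,0,1)`, regarded in `ℂ³`. -/
def khat3 : Fin 3 → ℂ := ![0, 0, 1]

/-- `K_m(s,s′) = ∫_{−π}^{π} K(s,s′,φ) e^{−imφ} dφ`. -/
def kernelMode (K : ℝ → ℝ → ℝ → ℂ) (m : ℤ) (s s' : ℝ) : ℂ :=
  ∫ φ in (-π)..π, K s s' φ * Complex.exp (-(Complex.I * (m : ℂ) * (φ : ℂ)))

/-- `K_m^{cos}(s,s′) = ∫_{−π}^{π} K(s,s′,φ) cos φ e^{−imφ} dφ`. -/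
def kernelModeCos (K : ℝ → ℝ → ℝ → ℂ) (m : ℤ) (s s' : ℝ) : ℂ :=
  ∫ φ in (-π)..π, K s s' φ * (Real.cos φ : ℂ) *
    Complex.exp (-(Complex.I * (m : ℂ) * (φ : ℂ)))

/-- `K_m^{sin}(s,s′) = ∫_{−π}^{π} K(s,s′,φ) sin φ e^{−imφ} dφ`. -/
def kernelModeSin (K : ℝ → ℝ → ℝ → ℂ) (m : ℤ) (s s' : ℝ) : ℂ :=
  ∫ φ in (-π)..π, K s s' φ * (Real.sin φ : ℂ) *
    Complex.exp (-(Complex.I * (m : ℂ) * (φ : ℂ)))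

theorem rhat3_sub (a b : ℝ) :
    rhat3 (a - b) = (Real.cos b : ℂ) • rhat3 a - (Real.sin b : ℂ) • thetahat3 a := by
  ext i
  fin_cases i <;> simp [rhat3, thetahat3, Complex.cos_sub, Complex.sin_sub] <;> ring

theorem thetahat3_sub (a b : ℝ) :
    thetahat3 (a - b) = (Real.cos b : ℂ) • thetahat3 a + (Real.sin b : ℂ) • rhat3 a := by
  ext i
  fin_cases i <;> simp [rhat3, thetahat3, Complex.cos_sub, Complex.sin_sub] <;> ring

theorem exp_mode_periodic (m : ℤ) :
    Function.Periodic (fun φ : ℝ => Complex.exp (-(Complex.I * (m : ℂ) * (φ : ℂ)))) (2 * π) := by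
  intro φ
  have h : -(Complex.I * (m : ℂ) * ((φ + 2 * π : ℝ) : ℂ))
      = -(Complex.I * (m : ℂ) * (φ : ℂ)) + ((-m : ℤ) : ℂ) * (2 * π * Complex.I) := by
    push_cast; ring
  simp only [h]
  rw [Complex.exp_add, Complex.exp_int_mul_two_pi_mul_I, mul_one]

theorem inner_integral_eq (m : ℤ) (θ : ℝ) (k : ℝ → ℂ) (hper : Function.Periodic k (2 * π))
    (hk : IntervalIntegrable k volume (-π) π) (ρ uτ uθ b c : ℂ) :
    (∫ θ' in (-π)..π, (k (θ - θ') * Complex.exp (Complex.I * (m : ℂ) * (θ' : ℂ)) * ρ) •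
        (uτ • (b • rhat3 θ' + c • khat3) + uθ • thetahat3 θ')) =
    Complex.exp (Complex.I * (m : ℂ) * (θ : ℂ)) •
      ((((∫ φ in (-π)..π, k φ * (Real.cos φ : ℂ) *
            Complex.exp (-(Complex.I * (m : ℂ) * (φ : ℂ)))) * b * uτ +
          (∫ φ in (-π)..π, k φ * (Real.sin φ : ℂ) *
            Complex.exp (-(Complex.I * (m : ℂ) * (φ : ℂ)))) * uθ) * ρ) • rhat3 θ +
       (((∫ φ in (-π)..π, k φ * (Real.cos φ : ℂ) *
            Complex.exp (-(Complex.I * (m : ℂ) * (φ : ℂ)))) * uθ -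
          (∫ φ in (-π)..π, k φ * (Real.sin φ : ℂ) *
            Complex.exp (-(Complex.I * (m : ℂ) * (φ : ℂ)))) * b * uτ) * ρ) • thetahat3 θ +
       ((∫ φ in (-π)..π, k φ * Complex.exp (-(Complex.I * (m : ℂ) * (φ : ℂ)))) * c * uτ * ρ) •
          khat3) := by
  set e : ℝ → ℂ := fun φ => Complex.exp (-(Complex.I * (m : ℂ) * (φ : ℂ))) with he
  have hec : Continuous e := by rw [he]; fun_prop
  set E := Complex.exp (Complex.I * (m : ℂ) * (θ : ℂ)) with hE
  set V1 : Fin 3 → ℂ := (E * ρ) • ((uτ * b) • rhat3 θ + uθ • thetahat3 θ) with hV1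
  set V2 : Fin 3 → ℂ := (E * ρ) • (uθ • rhat3 θ - (uτ * b) • thetahat3 θ) with hV2
  set V3 : Fin 3 → ℂ := (E * ρ * uτ * c) • khat3 with hV3
  set g : ℝ → Fin 3 → ℂ := fun φ =>
    (k φ * (Real.cos φ : ℂ) * e φ) • V1 + (k φ * (Real.sin φ : ℂ) * e φ) • V2 +
      (k φ * e φ) • V3 with hg
  have h1 : ∀ θ' : ℝ, (k (θ - θ') * Complex.exp (Complex.I * (m : ℂ) * (θ' : ℂ)) * ρ) •
        (uτ • (b • rhat3 θ' + c • khat3) + uθ • thetahat3 θ') = g (θ - θ') := by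
    intro θ'
    obtain ⟨φ, rfl⟩ : ∃ φ, θ' = θ - φ := ⟨θ - θ', by ring⟩
    have h2 : Complex.exp (Complex.I * (m : ℂ) * ((θ - φ : ℝ) : ℂ)) = E * e φ := by
      rw [hE, he, ← Complex.exp_add]; congr 1; push_cast; ring
    rw [h2, rhat3_sub, thetahat3_sub, sub_sub_cancel, hg, hV1, hV2, hV3]
    ext i
    simp only [Pi.smul_apply, Pi.add_apply, Pi.sub_apply, smul_eq_mul]
    ring
  have hgper : Function.Periodic g (2 * π) := by
    intro φ
    have h3 : e (φ + 2 * π) = e φ := exp_mode_periodic m φ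
    simp only [hg, h3, hper φ, Real.cos_add_two_pi, Real.sin_add_two_pi]
  have hA : IntervalIntegrable (fun φ => k φ * (Real.cos φ : ℂ) * e φ) volume (-π) π :=
    (hk.mul_continuousOn (by fun_prop)).mul_continuousOn hec.continuousOn
  have hB : IntervalIntegrable (fun φ => k φ * (Real.sin φ : ℂ) * e φ) volume (-π) π :=
    (hk.mul_continuousOn (by fun_prop)).mul_continuousOn hec.continuousOn
  have hC : IntervalIntegrable (fun φ => k φ * e φ) volume (-π) π :=
    hk.mul_continuousOn hec.continuousOn
  have h4 : (∫ θ' in (-π)..π, g (θ - θ')) = ∫ φ in (-π)..π, g φ := by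
    rw [intervalIntegral.integral_comp_sub_left]
    have := hgper.intervalIntegral_add_eq (θ - π) (-π)
    rw [show θ - π + 2 * π = θ - -π by ring, show -π + 2 * π = π by ring] at this
    exact this
  have hA' : IntervalIntegrable (fun φ => (k φ * (Real.cos φ : ℂ) * e φ) • V1) volume (-π) π :=
    ⟨Integrable.smul_const hA.1 V1, Integrable.smul_const hA.2 V1⟩
  have hB' : IntervalIntegrable (fun φ => (k φ * (Real.sin φ : ℂ) * e φ) • V2) volume (-π) π :=
    ⟨Integrable.smul_const hB.1 V2, Integrable.smul_const hB.2 V2⟩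
  have hC' : IntervalIntegrable (fun φ => (k φ * e φ) • V3) volume (-π) π :=
    ⟨Integrable.smul_const hC.1 V3, Integrable.smul_const hC.2 V3⟩
  rw [intervalIntegral.integral_congr (fun θ' _ => h1 θ'), h4, hg,
    intervalIntegral.integral_add (hA'.add hB') hC', intervalIntegral.integral_add hA' hB',
    intervalIntegral.integral_smul_const, intervalIntegral.integral_smul_const,
    intervalIntegral.integral_smul_const, hV1, hV2, hV3]
  ext i
  simp only [Pi.smul_apply, Pi.add_apply, Pi.sub_apply, smul_eq_mul]
  ring

/-- Integrating a curve written in a fixed cylindrical frame, coefficientwise. -/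
theorem outer_integral (L θ : ℝ) (hL : 0 < L) (E : ℂ) (hE : E ≠ 0) (F : ℝ → Fin 3 → ℂ)
    (A B C : ℝ → ℂ) (hF : IntervalIntegrable F volume 0 L)
    (h : ∀ x ∈ Set.Icc (0 : ℝ) L, F x = E • (A x • rhat3 θ + B x • thetahat3 θ + C x • khat3)) :
    (∫ x in (0 : ℝ)..L, F x) = E • ((∫ x in (0 : ℝ)..L, A x) • rhat3 θ +
      (∫ x in (0 : ℝ)..L, B x) • thetahat3 θ + (∫ x in (0 : ℝ)..L, C x) • khat3) := by
  have hcs : (Complex.cos θ) ^ 2 + (Complex.sin θ) ^ 2 = 1 := by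
    rw [add_comm]; exact Complex.sin_sq_add_cos_sq _
  have hcomp : ∀ i, IntervalIntegrable (fun x => F x i) volume 0 L := fun i =>
    ⟨hF.1.eval i, hF.2.eval i⟩
  have hint : ∀ i, (∫ x in (0 : ℝ)..L, F x) i = ∫ x in (0 : ℝ)..L, F x i := fun i =>
    ((ContinuousLinearMap.proj (R := ℂ) (φ := fun _ : Fin 3 => ℂ) i).intervalIntegral_comp_comm
      hF).symm
  have hu : Set.uIcc (0 : ℝ) L = Set.Icc 0 L := Set.uIcc_of_le hL.le
  have hA : (∫ x in (0 : ℝ)..L, A x) = E⁻¹ * (Complex.cos θ * (∫ x in (0 : ℝ)..L, F x 0) +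
      Complex.sin θ * (∫ x in (0 : ℝ)..L, F x 1)) := by
    rw [← intervalIntegral.integral_const_mul, ← intervalIntegral.integral_const_mul,
      ← intervalIntegral.integral_add ((hcomp 0).const_mul _) ((hcomp 1).const_mul _),
      ← intervalIntegral.integral_const_mul]
    refine intervalIntegral.integral_congr fun x hx => ?_
    rw [hu] at hx
    simp [h x hx, rhat3, thetahat3, khat3]
    field_simp
    linear_combination (-A x) * hcs
  have hB : (∫ x in (0 : ℝ)..L, B x) = E⁻¹ * (-Complex.sin θ * (∫ x in (0 : ℝ)..L, F x 0) +
      Complex.cos θ * (∫ x in (0 : ℝ)..L, F x 1)) := by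
    rw [← intervalIntegral.integral_const_mul, ← intervalIntegral.integral_const_mul,
      ← intervalIntegral.integral_add ((hcomp 0).const_mul _) ((hcomp 1).const_mul _),
      ← intervalIntegral.integral_const_mul]
    refine intervalIntegral.integral_congr fun x hx => ?_
    rw [hu] at hx
    simp [h x hx, rhat3, thetahat3, khat3]
    field_simp
    linear_combination (-B x) * hcs
  have hC : (∫ x in (0 : ℝ)..L, C x) = E⁻¹ * (∫ x in (0 : ℝ)..L, F x 2) := by
    rw [← intervalIntegral.integral_const_mul]
    refine intervalIntegral.integral_congr fun x hx => ?_
    rw [hu] at hx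
    simp [h x hx, rhat3, thetahat3, khat3]
    field_simp
  rw [hA, hB, hC]
  ext i
  rw [hint i]
  fin_cases i
  · simp [rhat3, thetahat3, khat3]
    field_simp
    linear_combination (-(∫ x in (0 : ℝ)..L, F x 0)) * hcs
  · simp [rhat3, thetahat3, khat3]
    field_simp
    linear_combination (-(∫ x in (0 : ℝ)..L, F x 1)) * hcs
  · simp [rhat3, thetahat3, khat3]
    field_simp

/-- Separation of variables for tangential vector-valued integral operators
on a body of revolution. -/
theorem vector_separation_of_variables
    (L : ℝ) (hL : 0 < L) (m : ℤ) (θ : ℝ) (s : ℝ) (hs : s ∈ Set.Icc (0 : ℝ) L)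
    (r z : ℝ → ℝ)
    (hr : ContDiffOn ℝ 1 r (Set.Icc (0 : ℝ) L))
    (hz : ContDiffOn ℝ 1 z (Set.Icc (0 : ℝ) L))
    (hrpos : ∀ s' ∈ Set.Icc (0 : ℝ) L, 0 < r s')
    (K : ℝ → ℝ → ℝ → ℂ)
    (hKper : ∀ s' ∈ Set.Icc (0 : ℝ) L, Function.Periodic (K s s') (2 * π))
    (hKint : ∀ s' ∈ Set.Icc (0 : ℝ) L, IntervalIntegrable (K s s') volume (-π) π)
    (uτ uθ : ℝ → ℂ)
    (hint : IntegrableOn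
      (fun p : ℝ × ℝ =>
        (K s p.1 (θ - p.2) * Complex.exp (Complex.I * (m : ℂ) * (p.2 : ℂ)) *
            (r p.1 : ℂ)) •
          (uτ p.1 •
              ((Complex.ofReal (derivWithin r (Set.Icc (0 : ℝ) L) p.1)) • rhat3 p.2 +
                (Complex.ofReal (derivWithin z (Set.Icc (0 : ℝ) L) p.1)) • khat3) +
            uθ p.1 • thetahat3 p.2))
      (Set.Icc (0 : ℝ) L ×ˢ Set.Icc (-π) π)) :
    (∫ s' in (0 : ℝ)..L, ∫ θ' in (-π)..π,
        (K s s' (θ - θ') * Complex.exp (Complex.I * (m : ℂ) * (θ' : ℂ)) *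
            (r s' : ℂ)) •
          (uτ s' •
              ((Complex.ofReal (derivWithin r (Set.Icc (0 : ℝ) L) s')) • rhat3 θ' +
                (Complex.ofReal (derivWithin z (Set.Icc (0 : ℝ) L) s')) • khat3) +
            uθ s' • thetahat3 θ')) =
      Complex.exp (Complex.I * (m : ℂ) * (θ : ℂ)) •
        ((∫ s' in (0 : ℝ)..L,
            (kernelModeCos K m s s' * (Complex.ofReal (derivWithin r (Set.Icc (0 : ℝ) L) s')) *
                uτ s' + kernelModeSin K m s s' * uθ s') * (r s' : ℂ)) • rhat3 θ +
          (∫ s' in (0 : ℝ)..L,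
            (kernelModeCos K m s s' * uθ s' -
                kernelModeSin K m s s' * (Complex.ofReal (derivWithin r (Set.Icc (0 : ℝ) L) s')) *
                  uτ s') * (r s' : ℂ)) • thetahat3 θ +
          (∫ s' in (0 : ℝ)..L,
            kernelMode K m s s' * (Complex.ofReal (derivWithin z (Set.Icc (0 : ℝ) L) s')) *
              uτ s' * (r s' : ℂ)) • khat3) := by
  refine outer_integral L θ hL _ (Complex.exp_ne_zero _) _ _ _ _ ?_ ?_
  · rw [IntegrableOn, Measure.volume_eq_prod, ← Measure.prod_restrict] at hint
    have h := hint.integral_prod_left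
    rw [intervalIntegrable_iff_integrableOn_Icc_of_le hL.le]
    refine h.congr (Filter.Eventually.of_forall fun x => ?_)
    simp only
    rw [intervalIntegral.integral_of_le (by linarith [Real.pi_pos]), integral_Icc_eq_integral_Ioc]
  · intro x hx
    exact inner_integral_eq m θ (K s x) (hKper x hx) (hKint x hx) _ _ _ _ _
end
end

section
/- Let r > 0, r′ > 0, z, z′ ∈ ℝ with (r, z) ≠ (r′, z′), and set χ = (r² + r′² + (z − z′)²)/(2 r r′). Then χ > 1, and for every m ∈ ℤ, ∫_{−π}^{π} e^{−imφ} / (4π √(r² + r′² − 2 r r′ cos φ + (z − z′)²)) dφ = 𝒬_m(χ) / (2π √(r r′)). -/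
open scoped Real
open MeasureTheory

noncomputable section

/-- Integral representation of the half-integer degree Legendre function of the
second kind: `𝒬_m(χ) = Q_{m−1/2}(χ) = (1/√2) ∫_0^π cos(mφ)/√(χ − cos φ) dφ`. -/
def legendreQhalf (m : ℤ) (χ : ℝ) : ℝ :=
  (1 / Real.sqrt 2) * ∫ φ in (0 : ℝ)..π, Real.cos ((m : ℝ) * φ) / Real.sqrt (χ - Real.cos φ)

/-- The azimuthal Fourier modes of the electrostatic Green's function
`1/(4π|x − x′|)` are `Q_{m−1/2}(χ)/(2π√(rr′))`. -/
theorem electrostatic_modal_greens_function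
    (r r' z z' : ℝ) (hr : 0 < r) (hr' : 0 < r')
    (hne : (r, z) ≠ (r', z'))
    (χ : ℝ) (hχ : χ = (r ^ 2 + r' ^ 2 + (z - z') ^ 2) / (2 * r * r')) :
    1 < χ ∧
    ∀ m : ℤ,
      (∫ φ in (-π)..π,
          Complex.exp (-(Complex.I * (m : ℂ) * (φ : ℂ))) /
            (4 * (π : ℂ) *
              (Real.sqrt (r ^ 2 + r' ^ 2 - 2 * r * r' * Real.cos φ + (z - z') ^ 2) : ℂ))) =
        ((legendreQhalf m χ / (2 * π * Real.sqrt (r * r')) : ℝ) : ℂ) := by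
  have hχ1 : 1 < χ := by
    rw [hχ, lt_div_iff₀ (by positivity)]
    by_cases h : r = r'
    · have hz : z - z' ≠ 0 := fun h0 => hne (by rw [h, sub_eq_zero.mp h0])
      have := sq_pos_of_ne_zero hz
      nlinarith [sq_nonneg (r - r')]
    · have := sq_pos_of_ne_zero (sub_ne_zero.mpr h)
      nlinarith [sq_nonneg (z - z')]
  refine ⟨hχ1, fun m => ?_⟩
  have hpos : ∀ φ : ℝ, 0 < χ - Real.cos φ := fun φ => by linarith [Real.cos_le_one φ]
  have hS : ∀ φ : ℝ,
      Real.sqrt (r ^ 2 + r' ^ 2 - 2 * r * r' * Real.cos φ + (z - z') ^ 2) =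
        Real.sqrt 2 * Real.sqrt (r * r') * Real.sqrt (χ - Real.cos φ) := by
    intro φ
    rw [← Real.sqrt_mul (by norm_num), ← Real.sqrt_mul (by positivity)]
    congr 1
    rw [hχ]
    field_simp
    ring
  have hsp : ∀ φ : ℝ, 0 < Real.sqrt (χ - Real.cos φ) := fun φ => Real.sqrt_pos.mpr (hpos φ)
  have h2 : 0 < Real.sqrt 2 := by positivity
  have hrr : 0 < Real.sqrt (r * r') := by positivity
  simp_rw [hS]
  set f : ℝ → ℂ := fun φ => Complex.exp (-(Complex.I * (m : ℂ) * (φ : ℂ))) /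
    (4 * (π : ℂ) * ((Real.sqrt 2 * Real.sqrt (r * r') * Real.sqrt (χ - Real.cos φ) : ℝ) : ℂ))
    with hf
  have hcont : Continuous f := by
    rw [hf]
    refine Continuous.div (by fun_prop) (by fun_prop) fun φ => ?_
    have h3 : (Real.sqrt 2 * Real.sqrt (r * r') * Real.sqrt (χ - Real.cos φ)) ≠ 0 :=
      (mul_pos (mul_pos h2 hrr) (hsp φ)).ne'
    refine mul_ne_zero (mul_ne_zero (by norm_num) ?_) ?_
    · exact_mod_cast Real.pi_ne_zero
    · exact_mod_cast h3
  have hcont' : Continuous fun φ => f (-φ) := hcont.comp continuous_neg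
  have hneg : (∫ φ in (-π)..0, f φ) = ∫ φ in (0 : ℝ)..π, f (-φ) := by
    rw [intervalIntegral.integral_comp_neg, neg_zero]
  rw [← intervalIntegral.integral_add_adjacent_intervals
    (hcont.intervalIntegrable (-π) 0) (hcont.intervalIntegrable 0 π), hneg,
    ← intervalIntegral.integral_add
      (hcont'.intervalIntegrable 0 π) (hcont.intervalIntegrable 0 π)]
  have key : ∀ φ : ℝ, f (-φ) + f φ =
      ((1 / Real.sqrt 2 / (2 * π * Real.sqrt (r * r')) *
        (Real.cos ((m : ℝ) * φ) / Real.sqrt (χ - Real.cos φ)) : ℝ) : ℂ) := by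
    intro φ
    have e1 : (Real.sqrt 2 : ℂ) ≠ 0 := by exact_mod_cast h2.ne'
    have e2 : (Real.sqrt (r * r') : ℂ) ≠ 0 := by exact_mod_cast hrr.ne'
    have e3 : (Real.sqrt (χ - Real.cos φ) : ℂ) ≠ 0 := by exact_mod_cast (hsp φ).ne'
    have e4 : (π : ℂ) ≠ 0 := by exact_mod_cast Real.pi_ne_zero
    have hc : Complex.exp (-(Complex.I * (m : ℂ) * ((-φ : ℝ) : ℂ))) =
        Complex.exp (((m : ℂ) * φ) * Complex.I) := by
      congr 1; push_cast; ring
    have hd : Complex.exp (-(Complex.I * (m : ℂ) * (φ : ℂ))) =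
        Complex.exp (-((m : ℂ) * φ) * Complex.I) := by
      congr 1; ring
    have hcos : ((Real.cos ((m : ℝ) * φ) : ℝ) : ℂ) = Complex.cos ((m : ℂ) * φ) := by
      push_cast; rfl
    simp only [hf, Real.cos_neg]
    rw [hc, hd]
    simp only [Complex.ofReal_mul, Complex.ofReal_div, hcos, Complex.ofReal_one,
      Complex.ofReal_ofNat]
    rw [Complex.cos]
    field_simp
    ring
  simp_rw [key]
  rw [intervalIntegral.integral_ofReal, intervalIntegral.integral_const_mul, legendreQhalf]
  congr 1
  ring
end
end

section
/- For every χ > 1 and every integer m ≥ 0, one has 0 < 𝒬_{m+1}(χ) < 𝒬_m(χ); that is, the sequence (Q_{m−1/2}(χ))_{m ≥ 0} is strictly positive and strictly decreasing in m. -/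
open scoped Real
open MeasureTheory

noncomputable section

/-- A bounded solution of the recurrence cannot have an increasing positive step. -/
lemma rec_no_growth (χ B : ℝ) (hχ : 1 < χ) (a : ℕ → ℝ)
    (hrec : ∀ n : ℕ, ((n : ℝ) + 3 / 2) * a (n + 2)
      = 2 * ((n : ℝ) + 1) * χ * a (n + 1) - ((n : ℝ) + 1 / 2) * a n)
    (hB : ∀ n, a n ≤ B) (m : ℕ) (h1 : a m ≤ a (m + 1)) (h2 : 0 < a (m + 1)) : False := by
  have key : ∀ k : ℕ, a (m + k) ≤ a (m + k + 1) ∧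
      a (m + 1) * (1 + k * (χ - 1)) ≤ a (m + k + 1) := by
    intro k
    induction k with
    | zero => simpa using h1
    | succ k ih =>
      obtain ⟨i1, i2⟩ := ih
      have hr := hrec (m + k)
      have hk : (0 : ℝ) ≤ (k : ℝ) := Nat.cast_nonneg k
      have hx : 0 < χ - 1 := by linarith
      have i3 : a (m + 1) ≤ a (m + k + 1) := by
        have : 0 ≤ a (m + 1) * (k * (χ - 1)) := by positivity
        linarith
      set M : ℝ := ((m + k : ℕ) : ℝ) with hM
      have hM0 : 0 ≤ M := Nat.cast_nonneg _
      have h4 : (M + 3 / 2) * (a (m + k + 2) - a (m + k + 1))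
          ≥ (M + 3 / 2) * ((χ - 1) * a (m + 1)) := by
        have e1 : (M + 1 / 2) * a (m + k) ≤ (M + 1 / 2) * a (m + k + 1) :=
          mul_le_mul_of_nonneg_left i1 (by linarith)
        have e2 : (χ - 1) * a (m + 1) ≤ (χ - 1) * a (m + k + 1) :=
          mul_le_mul_of_nonneg_left i3 hx.le
        have e3 : (2 * M + 2) * ((χ - 1) * a (m + 1)) ≤ (2 * M + 2) * ((χ - 1) * a (m + k + 1)) :=
          mul_le_mul_of_nonneg_left e2 (by linarith)
        have e4 : 0 ≤ (M + 1 / 2) * ((χ - 1) * a (m + 1)) := by positivity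
        linarith
      have h5 := le_of_mul_le_mul_left h4 (by linarith : 0 < M + 3 / 2)
      have e5 : 0 ≤ (χ - 1) * a (m + 1) := by positivity
      refine ⟨?_, ?_⟩
      · show a (m + k + 1) ≤ a (m + k + 2)
        linarith
      · show _ ≤ a (m + k + 2)
        push_cast
        linarith
  have hpos : 0 < a (m + 1) * (χ - 1) := mul_pos h2 (by linarith)
  obtain ⟨k, hk⟩ := exists_nat_gt (B / (a (m + 1) * (χ - 1)))
  rw [div_lt_iff₀ hpos] at hk
  have := (key k).2
  have := hB (m + k + 1)
  linarith

lemma rec_pos_anti (χ B : ℝ) (hχ : 1 < χ) (a : ℕ → ℝ)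
    (hrec : ∀ n : ℕ, ((n : ℝ) + 3 / 2) * a (n + 2)
      = 2 * ((n : ℝ) + 1) * χ * a (n + 1) - ((n : ℝ) + 1 / 2) * a n)
    (hB : ∀ n, |a n| ≤ B) (m : ℕ) :
    0 < a m → 0 < a (m + 1) ∧ a (m + 1) < a m := by
  intro hm
  have hup := rec_no_growth χ B hχ a hrec (fun n => (abs_le.1 (hB n)).2)
  have hdn := rec_no_growth χ B hχ (fun n => - a n) (fun n => by have := hrec n; linarith)
    (fun n => (neg_le_abs _).trans (hB n))
  have hp : 0 < a (m + 1) := by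
    by_contra hneg
    rcases lt_or_eq_of_le (not_lt.1 hneg) with h | h
    · exact hdn m (by linarith) (by linarith)
    · have hr := hrec m
      rw [h] at hr
      have hM : (0 : ℝ) ≤ m := Nat.cast_nonneg m
      have h1 : 0 < ((m : ℝ) + 1 / 2) * a m := by positivity
      have h2 : a (m + 2) < 0 := by
        by_contra h3
        have : 0 ≤ ((m : ℝ) + 3 / 2) * a (m + 2) := mul_nonneg (by linarith) (not_lt.1 h3)
        linarith
      exact hdn (m + 1) (by show - a (m + 1) ≤ - a (m + 2); linarith)
        (by show 0 < - a (m + 2); linarith)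
  exact ⟨hp, lt_of_not_ge fun h => hup m h hp⟩

def QI (χ : ℝ) (n : ℕ) : ℝ :=
  ∫ φ in (0 : ℝ)..π, Real.cos ((n : ℝ) * φ) / Real.sqrt (χ - Real.cos φ)

lemma sub_cos_pos {χ : ℝ} (hχ : 1 < χ) (φ : ℝ) : 0 < χ - Real.cos φ := by
  have := Real.cos_le_one φ
  linarith

lemma QI_cont {χ : ℝ} (hχ : 1 < χ) (n : ℝ) :
    Continuous fun φ : ℝ => Real.cos (n * φ) / Real.sqrt (χ - Real.cos φ) := by
  refine Continuous.div (by fun_prop) (by fun_prop) fun φ => ?_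
  exact (Real.sqrt_pos.2 (sub_cos_pos hχ φ)).ne'

lemma QI_rec {χ : ℝ} (hχ : 1 < χ) (n : ℕ) : ((n : ℝ) + 3 / 2) * QI χ (n + 2)
      = 2 * ((n : ℝ) + 1) * χ * QI χ (n + 1) - ((n : ℝ) + 1 / 2) * QI χ n := by
  have hd : ∀ φ : ℝ, HasDerivAt
      (fun φ => Real.sin (((n : ℝ) + 1) * φ) * Real.sqrt (χ - Real.cos φ))
      (((n : ℝ) + 1) * χ * (Real.cos (((n + 1 : ℕ) : ℝ) * φ) / Real.sqrt (χ - Real.cos φ))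
        - (n / 2 + 3 / 4) * (Real.cos (((n + 2 : ℕ) : ℝ) * φ) / Real.sqrt (χ - Real.cos φ))
        - (n / 2 + 1 / 4) * (Real.cos ((n : ℝ) * φ) / Real.sqrt (χ - Real.cos φ))) φ := by
    intro φ
    have hp := sub_cos_pos hχ φ
    have h1 : HasDerivAt (fun φ : ℝ => ((n : ℝ) + 1) * φ) ((n : ℝ) + 1) φ := by
      simpa using (hasDerivAt_id φ).const_mul ((n : ℝ) + 1)
    have h2 : HasDerivAt (fun φ : ℝ => χ - Real.cos φ) (Real.sin φ) φ := by
      simpa using (Real.hasDerivAt_cos φ).const_sub χ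
    have h3 := h1.sin.mul (h2.sqrt hp.ne')
    refine h3.congr_deriv ?_
    have hs : 0 < Real.sqrt (χ - Real.cos φ) := Real.sqrt_pos.2 hp
    have hsq : Real.sqrt (χ - Real.cos φ) ^ 2 = χ - Real.cos φ := Real.sq_sqrt hp.le
    have e2 : ((n + 2 : ℕ) : ℝ) * φ = ((n : ℝ) + 1) * φ + φ := by push_cast; ring
    have e0 : (n : ℝ) * φ = ((n : ℝ) + 1) * φ - φ := by ring
    have e1 : ((n + 1 : ℕ) : ℝ) * φ = ((n : ℝ) + 1) * φ := by push_cast; ring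
    rw [e2, e1, e0, Real.cos_add, Real.cos_sub]
    field_simp
    rw [hsq]
    ring
  have c0 := QI_cont hχ (n : ℝ)
  have c1 := QI_cont hχ ((n + 1 : ℕ) : ℝ)
  have c2 := QI_cont hχ ((n + 2 : ℕ) : ℝ)
  have hFTC := intervalIntegral.integral_eq_sub_of_hasDerivAt (a := 0) (b := π)
    (fun φ _ => hd φ)
    ((((c1.const_mul _).sub (c2.const_mul _)).sub (c0.const_mul _)).intervalIntegrable _ _)
  have c12 : Continuous fun φ : ℝ =>
      ((n : ℝ) + 1) * χ * (Real.cos (((n + 1 : ℕ) : ℝ) * φ) / Real.sqrt (χ - Real.cos φ))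
        - ((n : ℝ) / 2 + 3 / 4)
          * (Real.cos (((n + 2 : ℕ) : ℝ) * φ) / Real.sqrt (χ - Real.cos φ)) :=
    (c1.const_mul _).sub (c2.const_mul _)
  rw [intervalIntegral.integral_sub
      (c12.intervalIntegrable _ _)
      ((c0.const_mul _).intervalIntegrable _ _),
    intervalIntegral.integral_sub ((c1.const_mul _).intervalIntegrable _ _)
      ((c2.const_mul _).intervalIntegrable _ _),
    intervalIntegral.integral_const_mul, intervalIntegral.integral_const_mul,
    intervalIntegral.integral_const_mul] at hFTC
  have hs : Real.sin (((n : ℝ) + 1) * π) = 0 := by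
    have := Real.sin_nat_mul_pi (n + 1)
    push_cast at this
    exact this
  rw [hs] at hFTC
  simp only [mul_zero, Real.sin_zero, zero_mul, sub_zero] at hFTC
  unfold QI
  linarith

lemma QI_zero_pos {χ : ℝ} (hχ : 1 < χ) : 0 < QI χ 0 := by
  refine intervalIntegral.intervalIntegral_pos_of_pos
    ((QI_cont hχ ((0 : ℕ) : ℝ)).intervalIntegrable _ _) (fun φ => ?_) Real.pi_pos
  have := Real.sqrt_pos.2 (sub_cos_pos hχ φ)
  simp only [Nat.cast_zero, zero_mul, Real.cos_zero]
  positivity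

lemma QI_bound {χ : ℝ} (hχ : 1 < χ) (n : ℕ) : |QI χ n| ≤ QI χ 0 := by
  refine (intervalIntegral.abs_integral_le_integral_abs Real.pi_pos.le).trans ?_
  refine intervalIntegral.integral_mono_on Real.pi_pos.le
    ((QI_cont hχ (n : ℝ)).abs.intervalIntegrable _ _)
    ((QI_cont hχ ((0 : ℕ) : ℝ)).intervalIntegrable _ _) fun φ _ => ?_
  have := Real.sqrt_pos.2 (sub_cos_pos hχ φ)
  rw [abs_div, abs_of_pos this]
  simp only [Nat.cast_zero, zero_mul, Real.cos_zero]
  exact div_le_div_of_nonneg_right (Real.abs_cos_le_one _) this.le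

lemma QI_main {χ : ℝ} (hχ : 1 < χ) (n : ℕ) :
    0 < QI χ n ∧ 0 < QI χ (n + 1) ∧ QI χ (n + 1) < QI χ n := by
  have step := rec_pos_anti χ (QI χ 0) hχ (QI χ) (QI_rec hχ) (QI_bound hχ)
  have hp : ∀ k, 0 < QI χ k := by
    intro k
    induction k with
    | zero => exact QI_zero_pos hχ
    | succ k ih => exact (step k ih).1
  exact ⟨hp n, step n (hp n)⟩

/-- For `χ > 1`, the sequence `(Q_{m−1/2}(χ))_{m ≥ 0}` is strictly positive and
strictly decreasing in `m`. -/
theorem legendreQhalf_pos_strict_anti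
    (χ : ℝ) (hχ : 1 < χ) (m : ℤ) (hm : 0 ≤ m) :
    0 < legendreQhalf (m + 1) χ ∧ legendreQhalf (m + 1) χ < legendreQhalf m χ := by
  obtain ⟨n, rfl⟩ := Int.eq_ofNat_of_zero_le hm
  have e : ∀ k : ℕ, legendreQhalf (k : ℤ) χ = (1 / Real.sqrt 2) * QI χ k := by
    intro k
    simp only [legendreQhalf, QI, Int.cast_natCast]
  have e1 : legendreQhalf ((n : ℤ) + 1) χ = (1 / Real.sqrt 2) * QI χ (n + 1) := by
    rw [← e (n + 1)]
    push_cast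
    rfl
  have hc : 0 < 1 / Real.sqrt 2 := by positivity
  obtain ⟨-, h1, h2⟩ := QI_main hχ n
  rw [e1, e n]
  exact ⟨mul_pos hc h1, mul_lt_mul_of_pos_left h2 hc⟩
end
end
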